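/- Let N be a set of nooses on a surface Σ, for each point p of Σ let N(p) be the number of nooses of N containing p, and let P(N) = {p : N(p) ≥ 2}. If θ(N) := Σ_{p ∈ P(N)} (N(p) − 1) is finite, then the union of the nooses of N, viewed as an embedded graph with vertex set P(N), has at most θ(N) vertices, and the number of connected components of Σ minus the union of N is at most |N| + θ(N) + (genus-dependent constant). -/

import Mathlib

/-- The number of nooses of the family `N` passing through a point `p`. -/
noncomputable def nooseCount {X : Type} (N : Finset (Set X)) (p : X) : ℕ :=
  {s : Set X | s ∈ N ∧ p ∈ s}.ncard

section Nooses

open Set Topology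

/-- A nowhere vanishing continuous function on a simply connected space has a continuous
logarithm. -/
lemma exists_continuous_log {A : Type} [TopologicalSpace A] [SimplyConnectedSpace A]
    [LocallyPathConnectedSpace A] {f : A → ℂ} (hf : Continuous f) (h0 : ∀ x, f x ≠ 0)
    (a : A) (e : ℂ) (he : Complex.exp e = f a) :
    ∃ g : A → ℂ, Continuous g ∧ g a = e ∧ ∀ x, Complex.exp (g x) = f x := by
  obtain ⟨g, ⟨h1, h2⟩, -⟩ := Complex.isCoveringMapOn_exp.existsUnique_continuousMap_lifts
    ⟨f, hf⟩ (a₀ := a) (e₀ := e) he h0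
  exact ⟨g, g.continuous, h1, fun x => congrFun h2 x⟩

/-- Two continuous logarithms of the same function on a preconnected set differ by a constant
multiple of `2πi`. -/
lemma continuousOn_log_unique {A : Type} [TopologicalSpace A] {S : Set A} (hS : IsPreconnected S)
    {f g : A → ℂ} (hf : ContinuousOn f S) (hg : ContinuousOn g S)
    (h : ∀ x ∈ S, Complex.exp (f x) = Complex.exp (g x)) :
    ∃ n : ℤ, ∀ x ∈ S, f x = g x + n * (2 * Real.pi * Complex.I) := by
  rcases S.eq_empty_or_nonempty with rfl | ⟨x₀, hx₀⟩
  · exact ⟨0, by simp⟩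
  obtain ⟨n, hn⟩ := Complex.exp_eq_exp_iff_exists_int.1 (h x₀ hx₀)
  refine ⟨n, ?_⟩
  refine Complex.isCoveringMap_exp.eqOn_of_comp_eqOn hS hf (hg.add continuousOn_const) ?_ hx₀ hn
  intro x hx
  simp only [Function.comp, Subtype.mk.injEq]
  rw [h x hx, Complex.exp_add, Complex.exp_int_mul_two_pi_mul_I, mul_one]

/-- Tietze extension for a complex valued function on a closed subset of the plane. -/
lemma exists_continuous_eqOn {K : Set ℂ} (hK : IsClosed K) {φ : ℂ → ℂ} (hφ : ContinuousOn φ K) :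
    ∃ Φ : ℂ → ℂ, Continuous Φ ∧ EqOn Φ φ K := by
  obtain ⟨g, hg⟩ := ContinuousMap.exists_restrict_eq hK
    ⟨fun x : K => φ x, continuousOn_iff_continuous_domRestrict.1 hφ⟩
  exact ⟨g, g.continuous, fun x hx => congrArg (fun F => F ⟨x, hx⟩) hg⟩

/-- No nonzero power of `z - a` agrees with a nowhere vanishing continuous function of the plane
on a circle around `a`. -/
lemma zpow_eq_zero_of_extends {H : ℂ → ℂ} (hH : Continuous H) (h0 : ∀ z, H z ≠ 0) {a : ℂ} {ρ : ℝ}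
    (hρ : 0 < ρ) {m : ℤ} (h : ∀ z, ‖z - a‖ = ρ → H z = (z - a) ^ m) : m = 0 := by
  obtain ⟨L, hL, -, hexp⟩ := exists_continuous_log hH h0 0 (Complex.log (H 0))
    (Complex.exp_log (h0 0))
  have hρ' : (ρ : ℂ) ≠ 0 := by exact_mod_cast hρ.ne'
  have key := continuousOn_log_unique (A := ℝ) (S := univ) isPreconnected_univ
    (f := fun θ => L (a + ρ * Complex.exp (θ * Complex.I)))
    (g := fun θ => Complex.log ((ρ : ℂ) ^ m) + m * (θ * Complex.I))
    (by fun_prop) (by fun_prop) (by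
      intro θ _
      rw [hexp, h _ (by simp [Complex.norm_exp_ofReal_mul_I, abs_of_pos hρ]), Complex.exp_add,
        Complex.exp_log (zpow_ne_zero _ hρ'), Complex.exp_int_mul, add_sub_cancel_left, mul_zpow])
  obtain ⟨n, hn⟩ := key
  have e0 := hn 0 trivial
  have e1 := hn (2 * Real.pi) trivial
  have : Complex.exp (((2 * Real.pi : ℝ) : ℂ) * Complex.I) = 1 := by
    push_cast; exact Complex.exp_two_pi_mul_I
  simp only [this] at e1
  simp only [Complex.ofReal_zero, zero_mul, Complex.exp_zero] at e0
  rw [e0] at e1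
  have h2 : (m : ℂ) * (((2 * Real.pi : ℝ) : ℂ) * Complex.I) = 0 := by linear_combination -e1
  have h3 : ((2 * Real.pi : ℝ) : ℂ) * Complex.I ≠ 0 := by
    simp [Real.pi_ne_zero]
  exact_mod_cast (mul_eq_zero.1 h2).resolve_right h3

/-- Eilenberg's criterion: if `C` is a bounded open set with frontier in the closed set `K` and
`a ∈ C`, then `(z - a) ^ m * u z` with `u` nonvanishing on `closure C` has a continuous logarithm
on `K` only for `m = 0`. -/
lemma eq_zero_of_exists_log {K C : Set ℂ} (hK : IsClosed K) (hC : IsOpen C)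
    (hb : Bornology.IsBounded C) (hfr : frontier C ⊆ K) {a : ℂ} (ha : a ∈ C) {m : ℤ}
    {u φ : ℂ → ℂ} (hu : ContinuousOn u (closure C)) (hu0 : ∀ z ∈ closure C, u z ≠ 0)
    (hφ : ContinuousOn φ K) (h : ∀ z ∈ K, Complex.exp (φ z) = (z - a) ^ m * u z) : m = 0 := by
  classical
  obtain ⟨Φ, hΦ, hΦφ⟩ := exists_continuous_eqOn hK hφ
  have hne : ∀ z, z ∉ C → z - a ≠ 0 := fun z hz h => hz (by rwa [sub_eq_zero.1 h])
  obtain ⟨ρ, hρ⟩ := hb.subset_ball a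
  have hρ0 : 0 < ρ := by
    have := hρ ha
    rw [Metric.mem_ball] at this
    exact lt_of_le_of_lt dist_nonneg this
  refine zpow_eq_zero_of_extends
    (a := a) (H := fun z => if z ∈ C then Complex.exp (Φ z) * (u z)⁻¹ else (z - a) ^ m) ?_ ?_ hρ0 ?_
  · refine continuous_if ?_ ?_ ?_
    · intro z hz
      have hz' : z ∈ closure C := frontier_subset_closure hz
      rw [hΦφ (hfr hz), h z (hfr hz), mul_assoc, mul_inv_cancel₀ (hu0 z hz'), mul_one]
    · exact (Complex.continuous_exp.comp hΦ).continuousOn.mul (hu.inv₀ hu0)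
    · have : closure {z | ¬ z ∈ C} = Cᶜ := hC.isClosed_compl.closure_eq
      rw [this]
      exact ContinuousOn.zpow₀ (by fun_prop) _ fun z hz => Or.inl (hne z hz)
  · intro z
    split_ifs with hz
    · exact mul_ne_zero (Complex.exp_ne_zero _) (inv_ne_zero (hu0 z (subset_closure hz)))
    · exact zpow_ne_zero _ (hne z hz)
  · intro z hz
    have : z ∉ C := fun hzC => by
      have := hρ hzC
      rw [Metric.mem_ball, dist_eq_norm] at this
      exact this.ne hz
    simp [this]

lemma exists_extension_of_injOn {Y : Type} [TopologicalSpace Y] [TietzeExtension.{0, 0} Y]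
    {I : Set ℝ} (hI : IsCompact I) {α : ℝ → ℂ} (hα : ContinuousOn α I) (hinj : InjOn α I)
    {μ : ℝ → Y} (hμ : ContinuousOn μ I) :
    ∃ g : ℂ → Y, Continuous g ∧ ∀ t ∈ I, g (α t) = μ t := by
  have : CompactSpace I := isCompact_iff_compactSpace.1 hI
  have he : IsClosedEmbedding (fun t : I => α t) :=
    Continuous.isClosedEmbedding (continuousOn_iff_continuous_domRestrict.1 hα)
      (fun x y h => Subtype.ext (hinj x.2 y.2 h))
  obtain ⟨g, hg⟩ := ContinuousMap.exists_extension' he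
    ⟨fun t : I => μ t, continuousOn_iff_continuous_domRestrict.1 hμ⟩
  exact ⟨g, g.continuous, fun t ht => congrFun hg ⟨t, ht⟩⟩

lemma exists_glue_arc {I : Set ℝ} (hI : IsCompact I) {α : ℝ → ℂ} (hα : ContinuousOn α I)
    (hinj : InjOn α I) {μ : ℝ → ℂ} (hμ : ContinuousOn μ I) {Z : Set ℂ} (hZ : IsClosed Z)
    {ψ : ℂ → ℂ} (hψ : ContinuousOn ψ Z) (hag : ∀ t ∈ I, α t ∈ Z → μ t = ψ (α t)) :
    ∃ φ : ℂ → ℂ, ContinuousOn φ (α '' I ∪ Z) ∧ (∀ t ∈ I, φ (α t) = μ t) ∧ EqOn φ ψ Z := by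
  classical
  obtain ⟨g, hg, hgμ⟩ := exists_extension_of_injOn hI hα hinj hμ
  have hA : EqOn ((α '' I).piecewise g ψ) g (α '' I) := piecewise_eqOn _ _ _
  have hB : EqOn ((α '' I).piecewise g ψ) ψ Z := by
    intro z hz
    by_cases hzA : z ∈ α '' I
    · obtain ⟨t, ht, rfl⟩ := hzA
      rw [hA ⟨t, ht, rfl⟩, hgμ t ht, hag t ht hz]
    · exact piecewise_eq_of_notMem _ _ _ hzA
  refine ⟨(α '' I).piecewise g ψ, ?_, fun t ht => (hA ⟨t, ht, rfl⟩).trans (hgμ t ht), hB⟩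
  exact (hg.continuousOn.congr hA).union_of_isClosed (hψ.congr hB)
    (hI.image_of_continuousOn hα).isClosed hZ

lemma frontier_connectedComponentIn_diff_subset {X : Type} [TopologicalSpace X]
    [LocallyConnectedSpace X] {V A : Set X} (hV : IsOpen V) (hA : IsClosed A) (a : X) :
    frontier (connectedComponentIn (V \ A) a) ⊆ A ∪ frontier V := by
  intro z hz
  have hVA : IsOpen (V \ A) := hV.sdiff hA
  rw [(hVA.connectedComponentIn).frontier_eq] at hz
  by_contra hcon
  rw [mem_union, not_or] at hcon
  have hzV : z ∈ V := by
    by_contra hzV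
    refine hcon.2 ?_
    rw [hV.frontier_eq]
    exact ⟨closure_mono ((connectedComponentIn_subset _ _).trans sdiff_subset) hz.1, hzV⟩
  have hzm : z ∈ connectedComponentIn (V \ A) z := mem_connectedComponentIn ⟨hzV, hcon.1⟩
  obtain ⟨w, hw1, hw2⟩ := mem_closure_iff.1 hz.1 _ hVA.connectedComponentIn hzm
  apply hz.2
  rw [connectedComponentIn_eq hw2, ← connectedComponentIn_eq hw1]
  exact hzm

lemma div_mem_slitPlane {p a b z : ℂ} {ε : ℝ} (ha : a ∈ Metric.ball p ε) (hb : b ∈ Metric.ball p ε)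
    (hz : 3 * ε ≤ dist z p) : z - a ≠ 0 ∧ z - b ≠ 0 ∧ (z - a) / (z - b) ∈ Complex.slitPlane := by
  rw [Metric.mem_ball] at ha hb
  have hε : 0 < ε := lt_of_le_of_lt dist_nonneg ha
  have h1 : ε < dist z a := by linarith [dist_triangle z a p]
  have h2 : 2 * ε < dist z b := by linarith [dist_triangle z b p]
  have h3 : dist b a < 2 * ε := by linarith [dist_triangle_right b a p]
  have hb0 : z - b ≠ 0 := sub_ne_zero.2 (dist_pos.1 (by linarith))
  refine ⟨sub_ne_zero.2 (dist_pos.1 (by linarith)), hb0, ?_⟩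
  have : (z - a) / (z - b) = 1 + (b - a) / (z - b) := by field_simp; ring
  rw [this]
  apply Complex.mem_slitPlane_of_norm_lt_one
  rw [norm_div, ← dist_eq_norm, ← dist_eq_norm, div_lt_one (by linarith)]
  linarith

/-- An arc `α` in the plane through `α 0`, together with radii `ε` and `r` such that the part
`|t| ≤ δ` stays in the ball of radius `r` and the rest avoids the ball of radius `3 ε`. -/
structure PlaneArc (α : ℝ → ℂ) (d δ ε r : ℝ) : Prop where
  cont : ContinuousOn α (Icc (-d) d)
  inj : InjOn α (Icc (-d) d)
  delta_pos : 0 < δ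
  delta_lt : δ < d
  eps_pos : 0 < ε
  eps_le : 3 * ε ≤ r
  inner : ∀ t, |t| ≤ δ → dist (α t) (α 0) < r
  outer : ∀ t ∈ Icc (-d) d, δ ≤ |t| → 3 * ε ≤ dist (α t) (α 0)

namespace PlaneArc

variable {α : ℝ → ℂ} {d δ ε r : ℝ}

lemma exists_lift (h : PlaneArc α d δ ε r) {a b : ℂ}
    (ha : a ∈ Metric.ball (α 0) ε \ α '' Icc (-d) d)
    (hb : b ∈ Metric.ball (α 0) ε \ α '' Icc (-d) d) :
    ∃ (l : ℝ → ℂ) (n : ℤ), Continuous l ∧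
      (∀ t ∈ Icc (-d) d, Complex.exp (l t) = (α t - a) / (α t - b)) ∧
      (∀ t ∈ Icc (-d) (-δ), l t = Complex.log ((α t - a) / (α t - b))) ∧
      (∀ t ∈ Icc δ d, l t =
        Complex.log ((α t - a) / (α t - b)) + n * (2 * Real.pi * Complex.I)) := by
  have hδ := h.delta_pos
  have hd := h.delta_lt
  have hdd : -d ≤ d := by linarith
  have hne : ∀ c, c ∉ α '' Icc (-d) d → ∀ t ∈ Icc (-d) d, α t - c ≠ 0 :=
    fun c hc t ht e => hc ⟨t, ht, sub_eq_zero.1 e⟩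
  have hf : ContinuousOn (fun t => (α t - a) / (α t - b)) (Icc (-d) d) :=
    (h.cont.sub continuousOn_const).div (h.cont.sub continuousOn_const) (hne b hb.2)
  have hlog : ∀ S ⊆ Icc (-d) d, (∀ t ∈ S, δ ≤ |t|) →
      ContinuousOn (fun t => Complex.log ((α t - a) / (α t - b))) S ∧
      ∀ t ∈ S, Complex.exp (Complex.log ((α t - a) / (α t - b))) = (α t - a) / (α t - b) := by
    intro S hS hS'
    have hs := fun t ht => div_mem_slitPlane ha.1 hb.1 (h.outer t (hS ht) (hS' t ht))
    exact ⟨(hf.mono hS).clog fun t ht => (hs t ht).2.2,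
      fun t ht => Complex.exp_log (div_ne_zero (hs t ht).1 (hs t ht).2.1)⟩
  obtain ⟨l, hl, hl0, hexp⟩ := exists_continuous_log
    (f := IccExtend hdd fun t => (α t - a) / (α t - b))
    (continuousOn_iff_continuous_domRestrict.1 hf).Icc_extend'
    (fun x => div_ne_zero (hne a ha.2 _ (Subtype.coe_prop _)) (hne b hb.2 _ (Subtype.coe_prop _)))
    (-d) (Complex.log ((α (-d) - a) / (α (-d) - b))) (by
      rw [IccExtend_left]
      exact Complex.exp_log (div_ne_zero (hne a ha.2 _ ⟨le_rfl, hdd⟩)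
        (hne b hb.2 _ ⟨le_rfl, hdd⟩)))
  have hexp' : ∀ t ∈ Icc (-d) d, Complex.exp (l t) = (α t - a) / (α t - b) := by
    intro t ht
    rw [hexp, IccExtend_of_mem hdd _ ht]
  have hL : Icc (-d) (-δ) ⊆ Icc (-d) d := Icc_subset_Icc le_rfl (by linarith)
  have hR : Icc δ d ⊆ Icc (-d) d := Icc_subset_Icc (by linarith) le_rfl
  obtain ⟨cL, eL⟩ := hlog _ hL fun t ht => by
    rw [abs_of_neg (by linarith [ht.2])]; linarith [ht.2]
  obtain ⟨cR, eR⟩ := hlog _ hR fun t ht => ht.1.trans (le_abs_self t)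
  obtain ⟨n₀, hn₀⟩ := continuousOn_log_unique isPreconnected_Icc hl.continuousOn cL
    fun t ht => (hexp' t (hL ht)).trans (eL t ht).symm
  obtain ⟨n, hn⟩ := continuousOn_log_unique isPreconnected_Icc hl.continuousOn cR
    fun t ht => (hexp' t (hR ht)).trans (eR t ht).symm
  refine ⟨l, n, hl, hexp', ?_, hn⟩
  have : (n₀ : ℂ) * (2 * Real.pi * Complex.I) = 0 := by
    have := hn₀ (-d) ⟨le_rfl, by linarith⟩
    rw [hl0] at this
    exact (left_eq_add.1 this)
  intro t ht
  rw [hn₀ t ht, this, add_zero]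

lemma sphere_abs_gt (h : PlaneArc α d δ ε r) {t : ℝ} (ht : α t ∈ Metric.sphere (α 0) r) :
    δ < |t| := by
  by_contra! hle
  exact (h.inner t hle).ne ht

lemma frontier_component_subset (h : PlaneArc α d δ ε r) {I : Set ℝ} (hI : IsCompact I)
    (hId : I ⊆ Icc (-d) d) (a : ℂ) :
    frontier (connectedComponentIn (Metric.ball (α 0) r \ α '' I) a) ⊆
      α '' I ∪ Metric.sphere (α 0) r :=
  (frontier_connectedComponentIn_diff_subset Metric.isOpen_ball
    (hI.image_of_continuousOn (h.cont.mono hId)).isClosed a).trans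
    (union_subset_union_right _ Metric.frontier_ball_subset_sphere)

/-- If `(z - a) ^ m * u z` has a continuous logarithm on the arc together with the bounding circle,
where `u` is nonvanishing on the closure of the component of `a`, then `m = 0`. -/
lemma eq_zero_of_log (h : PlaneArc α d δ ε r) {I : Set ℝ} (hI : IsCompact I)
    (hId : I ⊆ Icc (-d) d) {a : ℂ} (ha : a ∈ Metric.ball (α 0) r \ α '' I) {m : ℤ} {u : ℂ → ℂ}
    {μ : ℝ → ℂ} {ψ : ℂ → ℂ}
    (hu : ContinuousOn u (closure (connectedComponentIn (Metric.ball (α 0) r \ α '' I) a)))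
    (hu0 : ∀ z ∈ closure (connectedComponentIn (Metric.ball (α 0) r \ α '' I) a), u z ≠ 0)
    (hμ : ContinuousOn μ I) (hψ : ContinuousOn ψ (Metric.sphere (α 0) r))
    (hag : ∀ t ∈ I, α t ∈ Metric.sphere (α 0) r → μ t = ψ (α t))
    (hμe : ∀ t ∈ I, Complex.exp (μ t) = (α t - a) ^ m * u (α t))
    (hψe : ∀ z ∈ Metric.sphere (α 0) r, Complex.exp (ψ z) = (z - a) ^ m * u z) : m = 0 := by
  have hA : IsClosed (α '' I) := (hI.image_of_continuousOn (h.cont.mono hId)).isClosed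
  obtain ⟨φ, hφ, h1, h2⟩ := exists_glue_arc hI (h.cont.mono hId) (h.inj.mono hId) hμ
    Metric.isClosed_sphere hψ hag
  refine eq_zero_of_exists_log (hA.union Metric.isClosed_sphere)
    (Metric.isOpen_ball.sdiff hA).connectedComponentIn
    (Metric.isBounded_ball.subset ((connectedComponentIn_subset _ _).trans sdiff_subset))
    (h.frontier_component_subset hI hId a) (mem_connectedComponentIn ha) hu hu0 hφ ?_
  rintro z (⟨t, ht, rfl⟩ | hz)
  · rw [h1 t ht, hμe t ht]
  · rw [h2 hz, hψe z hz]

lemma notMem_closure_component (h : PlaneArc α d δ ε r) {I : Set ℝ} (hI : IsCompact I)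
    (hId : I ⊆ Icc (-d) d) {a b : ℂ} (hb : b ∈ Metric.ball (α 0) r \ α '' I)
    (hab : b ∉ connectedComponentIn (Metric.ball (α 0) r \ α '' I) a) :
    b ∉ closure (connectedComponentIn (Metric.ball (α 0) r \ α '' I) a) := by
  intro hcl
  have hfr : b ∈ frontier (connectedComponentIn (Metric.ball (α 0) r \ α '' I) a) :=
    ⟨hcl, fun hi => hab (interior_subset hi)⟩
  rcases h.frontier_component_subset hI hId a hfr with h' | h'
  · exact hb.2 h'
  · exact (Metric.mem_ball.1 hb.1).ne h'

lemma continuousOn_log_sphere (h : PlaneArc α d δ ε r) {a b : ℂ} (ha : a ∈ Metric.ball (α 0) ε)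
    (hb : b ∈ Metric.ball (α 0) ε) :
    ContinuousOn (fun z => Complex.log ((z - a) / (z - b))) (Metric.sphere (α 0) r) ∧
    ∀ z ∈ Metric.sphere (α 0) r,
      Complex.exp (Complex.log ((z - a) / (z - b))) = (z - a) / (z - b) := by
  have hs := fun z (hz : z ∈ Metric.sphere (α 0) r) => div_mem_slitPlane ha hb
    (h.eps_le.trans (Metric.mem_sphere.1 hz).ge)
  refine ⟨ContinuousOn.clog ?_ fun z hz => (hs z hz).2.2,
    fun z hz => Complex.exp_log (div_ne_zero (hs z hz).1 (hs z hz).2.1)⟩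
  exact ContinuousOn.div (by fun_prop) (by fun_prop) fun z hz => (hs z hz).2.1

lemma eps_lt (h : PlaneArc α d δ ε r) : ε < r := by linarith [h.eps_le, h.eps_pos]

lemma mem_ball_diff (h : PlaneArc α d δ ε r) {I : Set ℝ} (hId : I ⊆ Icc (-d) d) {a : ℂ}
    (ha : a ∈ Metric.ball (α 0) ε \ α '' Icc (-d) d) : a ∈ Metric.ball (α 0) r \ α '' I :=
  ⟨Metric.ball_subset_ball h.eps_lt.le ha.1, fun h' => ha.2 (image_mono hId h')⟩

lemma mem_component_of_log (h : PlaneArc α d δ ε r) {I : Set ℝ} (hI : IsCompact I)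
    (hId : I ⊆ Icc (-d) d) {a b : ℂ} (ha : a ∈ Metric.ball (α 0) ε \ α '' Icc (-d) d)
    (hb : b ∈ Metric.ball (α 0) ε \ α '' Icc (-d) d) {μ : ℝ → ℂ} (hμ : ContinuousOn μ I)
    (hμe : ∀ t ∈ I, Complex.exp (μ t) = (α t - a) / (α t - b))
    (hag : ∀ t ∈ I, δ < |t| → μ t = Complex.log ((α t - a) / (α t - b))) :
    b ∈ connectedComponentIn (Metric.ball (α 0) r \ α '' I) a := by
  by_contra hab
  have hcl := h.notMem_closure_component hI hId (h.mem_ball_diff hId hb) hab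
  have hne : ∀ z ∈ closure (connectedComponentIn (Metric.ball (α 0) r \ α '' I) a),
      z - b ≠ 0 := fun z hz e => hcl (by rwa [← sub_eq_zero.1 e])
  obtain ⟨hc, he⟩ := h.continuousOn_log_sphere ha.1 hb.1
  refine one_ne_zero (h.eq_zero_of_log hI hId (h.mem_ball_diff hId ha) (m := 1)
    (u := fun z => (z - b)⁻¹) (ContinuousOn.inv₀ (by fun_prop) hne)
    (fun z hz => inv_ne_zero (hne z hz)) hμ hc (fun t ht hts => hag t ht (h.sphere_abs_gt hts))
    ?_ ?_)
  · intro t ht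
    rw [hμe t ht, zpow_one, div_eq_mul_inv]
  · intro z hz
    rw [he z hz, zpow_one, div_eq_mul_inv]

/-- An arc with a gap near its midpoint does not separate points near the midpoint. -/
lemma mem_component_of_gap (h : PlaneArc α d δ ε r) {a b : ℂ}
    (ha : a ∈ Metric.ball (α 0) ε \ α '' Icc (-d) d)
    (hb : b ∈ Metric.ball (α 0) ε \ α '' Icc (-d) d) {s η : ℝ} (hs : |s| < δ) (hη : 0 < η) :
    b ∈ connectedComponentIn
      (Metric.ball (α 0) r \ α '' (Icc (-d) d \ Ioo (s - η) (s + η))) a := by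
  classical
  obtain ⟨l, n, hl, hle, hL, hR⟩ := h.exists_lift ha hb
  rw [abs_lt] at hs
  refine h.mem_component_of_log (isCompact_Icc.diff isOpen_Ioo) sdiff_subset ha hb
    (μ := fun t => if t < s then l t else l t - n * (2 * Real.pi * Complex.I)) ?_ ?_ ?_
  · have hcover : Icc (-d) d \ Ioo (s - η) (s + η) ⊆ Iic (s - η) ∪ Ici (s + η) := by
      intro t ht
      by_contra hcon
      simp only [mem_union, mem_Iic, mem_Ici, not_or, not_le] at hcon
      exact ht.2 hcon
    refine ContinuousOn.mono (ContinuousOn.union_of_isClosed ?_ ?_ isClosed_Iic isClosed_Ici) hcover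
    · refine hl.continuousOn.congr fun t ht => ?_
      rw [mem_Iic] at ht
      exact if_pos (by linarith)
    · refine (hl.sub (continuous_const
        (y := n * (2 * Real.pi * Complex.I)))).continuousOn.congr fun t ht => ?_
      rw [mem_Ici] at ht
      exact if_neg (by linarith)
  · intro t ht
    split_ifs
    · exact hle t ht.1
    · rw [Complex.exp_sub, Complex.exp_int_mul_two_pi_mul_I, div_one, hle t ht.1]
  · intro t ht hδt
    rcases lt_abs.1 hδt with h1 | h1
    · have : ¬ t < s := by linarith
      simp only [this, if_false]
      rw [hR t ⟨h1.le, ht.1.2⟩, add_sub_cancel_right]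
    · have : t < s := by linarith
      simp only [this, if_true]
      exact hL t ⟨ht.1.1, by linarith⟩

/-- Near an interior point of an arc, among any three points of the complement, two lie in the
same component. -/
lemma mem_component_of_three (h : PlaneArc α d δ ε r) {a b c : ℂ}
    (ha : a ∈ Metric.ball (α 0) ε \ α '' Icc (-d) d)
    (hb : b ∈ Metric.ball (α 0) ε \ α '' Icc (-d) d)
    (hc : c ∈ Metric.ball (α 0) ε \ α '' Icc (-d) d) :
    b ∈ connectedComponentIn (Metric.ball (α 0) r \ α '' Icc (-d) d) a ∨
    c ∈ connectedComponentIn (Metric.ball (α 0) r \ α '' Icc (-d) d) a ∨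
    c ∈ connectedComponentIn (Metric.ball (α 0) r \ α '' Icc (-d) d) b := by
  by_contra! ⟨hab, hac, hbc⟩
  obtain ⟨l, n, hl, hle, hL, hR⟩ := h.exists_lift ha hb
  obtain ⟨l', n', hl', hle', hL', hR'⟩ := h.exists_lift hb hc
  have hclb := h.notMem_closure_component isCompact_Icc subset_rfl (h.mem_ball_diff subset_rfl hb)
    hab
  have hclc := h.notMem_closure_component isCompact_Icc subset_rfl (h.mem_ball_diff subset_rfl hc)
    hac
  set C := connectedComponentIn (Metric.ball (α 0) r \ α '' Icc (-d) d) a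
  have hneb : ∀ z ∈ closure C, z - b ≠ 0 := fun z hz e => hclb (by rwa [← sub_eq_zero.1 e])
  have hnec : ∀ z ∈ closure C, z - c ≠ 0 := fun z hz e => hclc (by rwa [← sub_eq_zero.1 e])
  obtain ⟨s1, s1e⟩ := h.continuousOn_log_sphere ha.1 hb.1
  obtain ⟨s2, s2e⟩ := h.continuousOn_log_sphere hb.1 hc.1
  have alg : ∀ z, z - b ≠ 0 → ((z - a) / (z - b)) ^ n' * ((z - b) / (z - c)) ^ (-n) =
      (z - a) ^ n' * ((z - b) ^ (-n - n') * (z - c) ^ n) := by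
    intro z hz
    rw [div_zpow, div_zpow, zpow_sub₀ hz, zpow_neg (z - c), div_inv_eq_mul]
    ring
  have hn' : n' = 0 := by
    refine h.eq_zero_of_log isCompact_Icc subset_rfl (h.mem_ball_diff subset_rfl ha) (m := n')
      (u := fun z => (z - b) ^ (-n - n') * (z - c) ^ n)
      (μ := fun t => n' * l t + (-n : ℤ) * l' t)
      (ψ := fun z => n' * Complex.log ((z - a) / (z - b)) +
        (-n : ℤ) * Complex.log ((z - b) / (z - c)))
      ?_ ?_ (by fun_prop) ?_ ?_ ?_ ?_
    · exact (ContinuousOn.zpow₀ (by fun_prop) _ fun z hz => Or.inl (hneb z hz)).mul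
        (ContinuousOn.zpow₀ (by fun_prop) _ fun z hz => Or.inl (hnec z hz))
    · exact fun z hz => mul_ne_zero (zpow_ne_zero _ (hneb z hz)) (zpow_ne_zero _ (hnec z hz))
    · exact (continuousOn_const.mul s1).add (continuousOn_const.mul s2)
    · intro t ht hts
      rcases lt_abs.1 (h.sphere_abs_gt hts) with h1 | h1
      · rw [hR t ⟨h1.le, ht.2⟩, hR' t ⟨h1.le, ht.2⟩]
        push_cast
        ring
      · rw [hL t ⟨ht.1, by linarith⟩, hL' t ⟨ht.1, by linarith⟩]
    · intro t ht
      rw [Complex.exp_add, Complex.exp_int_mul, Complex.exp_int_mul, hle t ht, hle' t ht]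
      exact alg _ fun e => hb.2 ⟨t, ht, sub_eq_zero.1 e⟩
    · intro z hz
      rw [Complex.exp_add, Complex.exp_int_mul, Complex.exp_int_mul, s1e z hz, s2e z hz]
      exact alg _ (div_mem_slitPlane ha.1 hb.1 (h.eps_le.trans (Metric.mem_sphere.1 hz).ge)).2.1
  refine hbc (h.mem_component_of_log isCompact_Icc subset_rfl hb hc hl'.continuousOn hle' ?_)
  intro t ht htδ
  rcases lt_abs.1 htδ with h1 | h1
  · rw [hR' t ⟨h1.le, ht.2⟩, hn', Int.cast_zero, zero_mul, add_zero]
  · exact hL' t ⟨ht.1, by linarith⟩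

end PlaneArc

/-- An arc in the plane has empty interior. -/
lemma interior_image_eq_empty {I : Set ℝ} (hI : IsCompact I) {α : ℝ → ℂ} (hα : ContinuousOn α I)
    (hinj : InjOn α I) : interior (α '' I) = ∅ := by
  by_contra hne
  obtain ⟨x, hx⟩ := nonempty_iff_ne_empty.2 hne
  obtain ⟨g, hg, hgα⟩ := exists_extension_of_injOn hI hα hinj continuousOn_id
  obtain ⟨ρ, hρ, hball⟩ := Metric.isOpen_iff.1 isOpen_interior x hx
  have hginj : InjOn g (Metric.ball x ρ) := by
    intro y hy z hz hyz
    obtain ⟨t, ht, rfl⟩ := interior_subset (hball hy)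
    obtain ⟨s, hs, rfl⟩ := interior_subset (hball hz)
    rw [hgα t ht, hgα s hs] at hyz
    exact congrArg α hyz
  let c : ℝ → ℂ := fun θ => x + ((ρ / 2 : ℝ) : ℂ) * Complex.exp (θ * Complex.I)
  have hc : ∀ θ, c θ ∈ Metric.ball x ρ := by
    intro θ
    rw [Metric.mem_ball, dist_eq_norm, add_sub_cancel_left, norm_mul,
      Complex.norm_exp_ofReal_mul_I, mul_one, Complex.norm_real, Real.norm_eq_abs, abs_of_pos]
    all_goals linarith
  have hanti : ∀ θ, Complex.exp ((θ + Real.pi : ℝ) * Complex.I) =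
      -Complex.exp (θ * Complex.I) := by
    intro θ
    push_cast
    rw [add_mul, Complex.exp_add, Complex.exp_pi_mul_I]
    ring
  let f : ℝ → ℝ := fun θ => g (c θ) - g (c (θ + Real.pi))
  have hfc : Continuous f := by fun_prop
  have hper : c (0 + Real.pi + Real.pi) = c 0 := by
    simp only [c]
    rw [hanti, hanti, neg_neg]
  have hf : f (0 + Real.pi) = - f 0 := by
    simp only [f, hper]
    ring
  have hmem : (0 : ℝ) ∈ f '' (uIcc 0 (0 + Real.pi)) := by
    refine intermediate_value_uIcc hfc.continuousOn ?_
    rw [hf, mem_uIcc]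
    rcases le_total (f 0) 0 with h | h
    · left; constructor <;> linarith
    · right; constructor <;> linarith
  obtain ⟨θ, -, hθ⟩ := hmem
  have := hginj (hc _) (hc _) (sub_eq_zero.1 hθ)
  simp only [c, hanti, add_right_inj] at this
  have h2 : Complex.exp (θ * Complex.I) = 0 := by
    have hρ2 : ((ρ / 2 : ℝ) : ℂ) ≠ 0 := by exact_mod_cast (by linarith : ρ / 2 ≠ 0)
    have := mul_left_cancel₀ hρ2 this
    linear_combination this / 2
  exact Complex.exp_ne_zero _ h2

lemma exists_planeArc {α : ℝ → ℂ} {d r : ℝ} (hd : 0 < d) (hr : 0 < r)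
    (hα : ContinuousOn α (Icc (-d) d)) (hinj : InjOn α (Icc (-d) d)) :
    ∃ δ ε, PlaneArc α d δ ε r := by
  have h0 : ContinuousAt α 0 := hα.continuousAt (Icc_mem_nhds (by linarith) hd)
  obtain ⟨δ', hδ', hδr⟩ := Metric.continuousAt_iff.1 h0 r hr
  have hδ : 0 < min (δ' / 2) (d / 2) := by positivity
  have hcpt : IsCompact (Icc (-d) d ∩ {t | min (δ' / 2) (d / 2) ≤ |t|}) :=
    isCompact_Icc.inter_right (isClosed_le continuous_const continuous_abs)
  have hcl := (hcpt.image_of_continuousOn (hα.mono inter_subset_left)).isClosed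
  have hnot : α 0 ∉ α '' (Icc (-d) d ∩ {t | min (δ' / 2) (d / 2) ≤ |t|}) := by
    rintro ⟨t, ⟨ht, htδ⟩, he⟩
    have := hinj ht ⟨by linarith, hd.le⟩ he
    rw [mem_ofPred_eq, this, abs_zero] at htδ
    linarith
  obtain ⟨ρ, hρ, hball⟩ := Metric.isOpen_iff.1 hcl.isOpen_compl _ hnot
  refine ⟨min (δ' / 2) (d / 2), min ρ r / 3, hα, hinj, hδ,
    (min_le_right _ _).trans_lt (by linarith), by positivity,
    by linarith [min_le_right ρ r], ?_, ?_⟩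
  · intro t ht
    refine hδr ?_
    rw [Real.dist_0_eq_abs]
    linarith [min_le_left (δ' / 2) (d / 2)]
  · intro t ht htδ
    by_contra! hlt
    exact hball (Metric.mem_ball.2 (by linarith [min_le_left ρ r])) ⟨t, ⟨ht, htδ⟩, rfl⟩

lemma PlaneArc.exists_two_points {α : ℝ → ℂ} {d δ ε r : ℝ} (h : PlaneArc α d δ ε r) :
    ∃ a ∈ Metric.ball (α 0) ε \ α '' Icc (-d) d, ∃ b ∈ Metric.ball (α 0) ε \ α '' Icc (-d) d,
      ∀ x ∈ Metric.ball (α 0) ε \ α '' Icc (-d) d,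
        x ∈ connectedComponentIn (Metric.ball (α 0) r \ α '' Icc (-d) d) a ∨
        x ∈ connectedComponentIn (Metric.ball (α 0) r \ α '' Icc (-d) d) b := by
  have hne : (Metric.ball (α 0) ε \ α '' Icc (-d) d).Nonempty := by
    by_contra hemp
    rw [not_nonempty_iff_eq_empty, sdiff_eq_empty] at hemp
    have := interior_maximal hemp Metric.isOpen_ball (Metric.mem_ball_self h.eps_pos)
    rwa [interior_image_eq_empty isCompact_Icc h.cont h.inj] at this
  obtain ⟨a, ha⟩ := hne
  by_cases hall : ∀ x ∈ Metric.ball (α 0) ε \ α '' Icc (-d) d,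
      x ∈ connectedComponentIn (Metric.ball (α 0) r \ α '' Icc (-d) d) a
  · exact ⟨a, ha, a, ha, fun x hx => Or.inl (hall x hx)⟩
  · push Not at hall
    obtain ⟨b, hb, hab⟩ := hall
    refine ⟨a, ha, b, hb, fun x hx => ?_⟩
    rcases h.mem_component_of_three ha hb hx with h1 | h1 | h1
    exacts [absurd h1 hab, Or.inl h1, Or.inr h1]

section LocConst

variable {X : Type} [TopologicalSpace X]

/-- `f` is locally constant at every point of `U`. -/
def LocConstOn (U : Set X) (f : X → ℝ) : Prop := ∀ x ∈ U, ∀ᶠ y in 𝓝 x, f y = f x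

/-- `f` is constant on the part of `U` that is near `p`. -/
def NearConst (U : Set X) (f : X → ℝ) (p : X) : Prop := ∃ c, ∀ᶠ x in 𝓝 p, x ∈ U → f x = c

lemma LocConstOn.eq_of_isPreconnected {U S : Set X} {f : X → ℝ} (hf : LocConstOn U f)
    (hS : IsPreconnected S) (hSU : S ⊆ U) {x y : X} (hx : x ∈ S) (hy : y ∈ S) : f x = f y := by
  have : PreconnectedSpace S := isPreconnected_iff_preconnectedSpace.1 hS
  have hl : IsLocallyConstant (fun z : S => f z) := by
    rw [IsLocallyConstant.iff_eventually_eq]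
    exact fun z => continuous_subtype_val.continuousAt.eventually (hf z (hSU z.2))
  exact hl.apply_eq_of_preconnectedSpace ⟨x, hx⟩ ⟨y, hy⟩

lemma isOpen_nearConst (U : Set X) (f : X → ℝ) : IsOpen {p | NearConst U f p} := by
  rw [isOpen_iff_mem_nhds]
  rintro p ⟨c, hc⟩
  filter_upwards [eventually_eventually_nhds.2 hc] with q hq
  exact ⟨c, hq⟩

/-- The space of functions that are locally constant on `U` and vanish elsewhere. -/
def locConstSubmodule (U : Set X) : Submodule ℝ (X → ℝ) where
  carrier := {f | LocConstOn U f ∧ ∀ x ∉ U, f x = 0}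
  add_mem' {f g} hf hg := ⟨fun x hx => by
      filter_upwards [hf.1 x hx, hg.1 x hx] with y h1 h2
      simp [h1, h2], fun x hx => by simp [hf.2 x hx, hg.2 x hx]⟩
  zero_mem' := ⟨fun x _ => Filter.Eventually.of_forall fun _ => rfl, fun _ _ => rfl⟩
  smul_mem' c f hf := ⟨fun x hx => by
      filter_upwards [hf.1 x hx] with y h1
      simp [h1], fun x hx => by simp [hf.2 x hx]⟩

/-- A locally constant function on a dense open part `U'` of `U` which is constant near each point
of `U` extends to `U`. -/
lemma exists_extension_of_nearConst {U U' : Set X} (hU : IsOpen U) (hsub : U' ⊆ U) {f : X → ℝ}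
    (hnear : ∀ p ∈ U, NearConst U' f p)
    (hdense : ∀ p ∈ U, ∃ᶠ x in 𝓝 p, x ∈ U') :
    ∃ g ∈ locConstSubmodule U, ∀ x ∈ U', g x = f x := by
  classical
  have : ∀ p, ∃ c, p ∈ U → ∀ᶠ x in 𝓝 p, x ∈ U' → f x = c := fun p => by
    by_cases hp : p ∈ U
    · obtain ⟨c, hc⟩ := hnear p hp
      exact ⟨c, fun _ => hc⟩
    · exact ⟨0, fun h => absurd h hp⟩
  choose c hc using this
  refine ⟨fun x => if x ∈ U then c x else 0, ⟨fun x hx => ?_, fun x hx => if_neg hx⟩,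
    fun x hx => ?_⟩
  · filter_upwards [hU.mem_nhds hx, eventually_eventually_nhds.2 (hc x hx)] with y hy hxy
    simp only [hx, hy, if_true]
    obtain ⟨z, hz, h1, h2⟩ := ((hdense y hy).and_eventually (hxy.and (hc y hy))).exists
    rw [← h1 hz, ← h2 hz]
  · simp only [hsub hx, if_true]
    exact ((hc x (hsub hx)).self_of_nhds hx).symm

/-- Restriction of locally constant functions to a smaller open set. -/
noncomputable def locConstRestrict {U U' : Set X} (hU' : IsOpen U') (hsub : U' ⊆ U) :
    locConstSubmodule U →ₗ[ℝ] locConstSubmodule U' where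
  toFun f := ⟨U'.indicator f.1, fun x hx => by
      filter_upwards [f.2.1 x (hsub hx), hU'.mem_nhds hx] with y h1 h2
      rw [indicator_of_mem hx, indicator_of_mem h2, h1], fun x hx => indicator_of_notMem hx _⟩
  map_add' f g := Subtype.ext (indicator_add _ _ _)
  map_smul' c f := Subtype.ext (indicator_const_smul U' c f.1)

/-- If `n` linear conditions suffice for functions locally constant on `U'` to extend to `U`, then
the dimension of the space of locally constant functions grows by at most `n`. -/
lemma rank_locConstSubmodule_le {U U' : Set X} (hU' : IsOpen U') (hsub : U' ⊆ U) {n : ℕ}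
    (a b : Fin n → X)
    (h : ∀ f ∈ locConstSubmodule U', (∀ i, f (a i) = f (b i)) →
      ∃ g ∈ locConstSubmodule U, ∀ x ∈ U', g x = f x) :
    Module.rank ℝ (locConstSubmodule U') ≤ Module.rank ℝ (locConstSubmodule U) + n := by
  let J : locConstSubmodule U' →ₗ[ℝ] (Fin n → ℝ) :=
    { toFun := fun f i => f.1 (a i) - f.1 (b i)
      map_add' := fun f g => by
        ext i
        simp only [Submodule.coe_add, Pi.add_apply]
        ring
      map_smul' := fun c f => by
        ext i
        simp only [Submodule.coe_smul, Pi.smul_apply, smul_eq_mul, RingHom.id_apply]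
        ring }
  have hker : LinearMap.ker J ≤ LinearMap.range (locConstRestrict hU' hsub) := by
    intro f hf
    obtain ⟨g, hg, hgf⟩ := h f.1 f.2 fun i => sub_eq_zero.1 (congrFun (LinearMap.mem_ker.1 hf) i)
    refine ⟨⟨g, hg⟩, Subtype.ext (funext fun x => ?_)⟩
    by_cases hx : x ∈ U'
    · change U'.indicator g x = f.1 x
      rw [indicator_of_mem hx, hgf x hx]
    · change U'.indicator g x = f.1 x
      rw [indicator_of_notMem hx, f.2.2 x hx]
  rw [← LinearMap.rank_range_add_rank_ker J, add_comm]
  refine add_le_add ((Submodule.rank_mono hker).trans (rank_range_le _)) ?_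
  exact (Submodule.rank_le _).trans (by simp)

lemma natCard_connectedComponents_le [LocallyConnectedSpace X] {U : Set X} (hU : IsOpen U) {m : ℕ}
    (h : Module.rank ℝ (locConstSubmodule U) ≤ m) : Nat.card (ConnectedComponents U) ≤ m := by
  classical
  rcases finite_or_infinite (ConnectedComponents U) with hfin | hinf
  swap
  · rw [Nat.card_eq_zero_of_infinite]
    exact Nat.zero_le m
  have := Fintype.ofFinite (ConnectedComponents U)
  have := hU.locallyConnectedSpace
  let F : (ConnectedComponents U → ℝ) →ₗ[ℝ] locConstSubmodule U :=
    { toFun := fun g => ⟨fun x => if hx : x ∈ U then g (ConnectedComponents.mk ⟨x, hx⟩) else 0, by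
        refine ⟨fun x hx => ?_, fun x hx => dif_neg hx⟩
        have hopen : IsOpen (Subtype.val '' connectedComponent (⟨x, hx⟩ : U)) :=
          hU.isOpenMap_subtype_val _ isOpen_connectedComponent
        filter_upwards [hopen.mem_nhds ⟨⟨x, hx⟩, mem_connectedComponent, rfl⟩]
        rintro _ ⟨y, hy, rfl⟩
        simp only [hx, y.2, dif_pos]
        exact congrArg g (ConnectedComponents.coe_eq_coe'.2 hy)⟩
      map_add' := fun f g => by
        ext x
        by_cases hx : x ∈ U <;> simp [hx]
      map_smul' := fun c g => by
        ext x
        by_cases hx : x ∈ U <;> simp [hx] }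
  have hF : Function.Injective F := by
    intro f g hfg
    ext y
    obtain ⟨x, rfl⟩ := ConnectedComponents.surjective_coe y
    have := congrFun (congrArg Subtype.val hfg) x.1
    simpa [F] using this
  have := (LinearMap.rank_le_of_injective F hF).trans h
  rw [rank_fun', Nat.cast_le] at this
  rwa [Nat.card_eq_fintype_card]

lemma exists_rank_locConstSubmodule_univ_le (X : Type) [TopologicalSpace X] [CompactSpace X]
    [LocallyConnectedSpace X] :
    ∃ c : ℕ, Module.rank ℝ (locConstSubmodule (univ : Set X)) ≤ c := by
  obtain ⟨t, ht⟩ := isCompact_univ.elim_finite_subcover (fun x : X => connectedComponent x)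
    (fun _ => isOpen_connectedComponent) fun x _ => mem_iUnion.2 ⟨x, mem_connectedComponent⟩
  let F : locConstSubmodule (univ : Set X) →ₗ[ℝ] (t → ℝ) :=
    (LinearMap.funLeft ℝ ℝ (Subtype.val : t → X)).comp (Submodule.subtype _)
  have hF : Function.Injective F := by
    intro f g hfg
    ext x
    obtain ⟨y, hy, hxy⟩ := mem_iUnion₂.1 (ht (mem_univ x))
    rw [f.2.1.eq_of_isPreconnected isPreconnected_connectedComponent (subset_univ _) hxy
      mem_connectedComponent, g.2.1.eq_of_isPreconnected isPreconnected_connectedComponent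
      (subset_univ _) hxy mem_connectedComponent]
    exact congrFun hfg ⟨y, hy⟩
  exact ⟨t.card, (LinearMap.rank_le_of_injective F hF).trans (by simp)⟩

end LocConst

lemma exists_loop_param {X : Type} [TopologicalSpace X] {s : Set X} (h : s ≃ₜ Circle) {p : X}
    (hp : p ∈ s) : ∃ σ : ℝ → X, Continuous σ ∧ σ 0 = p ∧ σ '' Icc (-Real.pi) Real.pi = s ∧
      InjOn σ (Ioc (-Real.pi) Real.pi) ∧ ∀ t ∈ Icc (-Real.pi) Real.pi, σ t = σ 0 → t = 0 := by
  refine ⟨fun t => h.symm (h ⟨p, hp⟩ * Circle.exp t), by fun_prop, by simp, ?_, ?_, ?_⟩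
  · ext x
    constructor
    · rintro ⟨t, -, rfl⟩
      exact Subtype.coe_prop _
    · intro hx
      refine ⟨Complex.arg ((h ⟨p, hp⟩)⁻¹ * h ⟨x, hx⟩ : Circle),
        ⟨(Complex.neg_pi_lt_arg _).le, Complex.arg_le_pi _⟩, ?_⟩
      simp only [Circle.exp_arg, mul_inv_cancel_left, Homeomorph.symm_apply_apply]
  · intro t ht t' ht' he
    have := mul_left_cancel (h.symm.injective (Subtype.ext he))
    rw [← Circle.arg_exp ht.1 ht.2, ← Circle.arg_exp ht'.1 ht'.2, this]
  · intro t ht he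
    have h1 := mul_left_cancel (h.symm.injective (Subtype.ext he))
    rw [Circle.exp_zero] at h1
    have h2 : Real.cos t = 1 := by
      rw [← Complex.exp_ofReal_mul_I_re, ← Circle.coe_exp, h1, Circle.coe_one, Complex.one_re]
    have := Real.pi_pos
    exact (Real.cos_eq_one_iff_of_lt_of_lt (by linarith [ht.1]) (by linarith [ht.2])).1 h2

/-- The local structure of the complement of `K ∪ s` at a point `p` of the noose `s` outside `K`:
locally there are at most two sides, and a locally constant function which extends across some
nearby point of `s` also extends across `p`. -/
lemma exists_local_sides {X : Type} [TopologicalSpace X] [T2Space X] {K s : Set X}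
    (hK : IsClosed K) (h : s ≃ₜ Circle) {p : X} (hp : p ∈ s \ K) (e : OpenPartialHomeomorph X ℂ)
    (hpe : p ∈ e.source) :
    ∃ a b, ∃ M ∈ 𝓝 p,
      (∀ f, LocConstOn (K ∪ s)ᶜ f → f a = f b → NearConst (K ∪ s)ᶜ f p) ∧
      (∀ q ∈ M ∩ s, ∀ f, LocConstOn (K ∪ s)ᶜ f → NearConst (K ∪ s)ᶜ f q →
        NearConst (K ∪ s)ᶜ f p) ∧
      ∃ᶠ x in 𝓝 p, x ∈ (K ∪ s)ᶜ := by
  classical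
  obtain ⟨σ, hσ, hσ0, hσs, hσi, hσz⟩ := exists_loop_param h hp.1
  have hpi := Real.pi_pos
  have hO : IsOpen (e.source ∩ Kᶜ) := e.open_source.inter hK.isOpen_compl
  obtain ⟨d', hd', hball⟩ := Metric.isOpen_iff.1 (hO.preimage hσ) 0
    (by rw [mem_preimage, hσ0]; exact ⟨hpe, hp.2⟩)
  obtain ⟨d, hd, hdd', hdpi⟩ : ∃ d, 0 < d ∧ d < d' ∧ d < Real.pi :=
    ⟨min d' Real.pi / 2, by positivity, by linarith [min_le_left d' Real.pi, lt_min hd' hpi],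
      by linarith [min_le_right d' Real.pi, lt_min hd' hpi]⟩
  have hσO : ∀ t ∈ Icc (-d) d, σ t ∈ e.source ∩ Kᶜ := fun t ht => hball (by
    rw [Metric.mem_ball, Real.dist_0_eq_abs]
    exact (abs_le.2 ht).trans_lt hdd')
  have hdsub : Icc (-d) d ⊆ Ioc (-Real.pi) Real.pi :=
    fun t ht => ⟨by linarith [ht.1], by linarith [ht.2]⟩
  have hfar : ∀ δ > 0, (σ '' (Icc (-Real.pi) Real.pi ∩ {t | δ ≤ |t|}))ᶜ ∈ 𝓝 p := by
    intro δ hδ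
    refine ((isCompact_Icc.inter_right (isClosed_le continuous_const continuous_abs)).image
      hσ).isClosed.isOpen_compl.mem_nhds ?_
    rintro ⟨t, ⟨ht, htδ⟩, he⟩
    rw [mem_ofPred_eq, hσz t ht (he.trans hσ0.symm), abs_zero] at htδ
    linarith
  have hnear : ∀ δ > 0, ∀ x ∈ s, x ∈ (σ '' (Icc (-Real.pi) Real.pi ∩ {t | δ ≤ |t|}))ᶜ →
      ∃ t, |t| < δ ∧ σ t = x := by
    intro δ _ x hx hxn
    obtain ⟨t, ht, rfl⟩ := hσs.symm.subset hx
    exact ⟨t, not_le.1 fun hle => hxn ⟨t, ⟨ht, hle⟩, rfl⟩, rfl⟩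
  have hV : e.source ∩ Kᶜ ∩ (σ '' (Icc (-Real.pi) Real.pi ∩ {t | d ≤ |t|}))ᶜ ∈ 𝓝 p :=
    Filter.inter_mem (hO.mem_nhds ⟨hpe, hp.2⟩) (hfar d hd)
  have hsymm : Filter.Tendsto e.symm (𝓝 (e p)) (𝓝 p) := e.tendsto_symm hpe
  obtain ⟨r, hr, hrV⟩ := Metric.mem_nhds_iff.1
    (Filter.inter_mem (e.open_target.mem_nhds (e.map_source hpe)) (hsymm hV))
  have hα0 : (e ∘ σ) 0 = e p := congrArg e hσ0
  have hαc : ContinuousOn (e ∘ σ) (Icc (-d) d) :=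
    e.continuousOn.comp hσ.continuousOn fun t ht => (hσO t ht).1
  have hαi : InjOn (e ∘ σ) (Icc (-d) d) :=
    e.injOn.comp (hσi.mono hdsub) fun t ht => (hσO t ht).1
  obtain ⟨δ, ε, hA⟩ := exists_planeArc hd hr hαc hαi
  have hsides : ∀ z ∈ Metric.ball (e p) r, e.symm z ∈ K ∪ s →
      ∃ t ∈ Icc (-d) d, e.symm z = σ t ∧ z = (e ∘ σ) t := by
    intro z hz hzs
    obtain ⟨hzt, ⟨-, hzK⟩, hzf⟩ := hrV hz
    obtain ⟨t, ht, hte⟩ := hnear d hd _ (hzs.resolve_left hzK) hzf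
    exact ⟨t, abs_le.1 ht.le, hte.symm, by rw [Function.comp, hte, e.right_inv hzt]⟩
  have hmaps : ∀ S ⊆ Metric.ball (e p) r, IsPreconnected S → IsPreconnected (e.symm '' S) :=
    fun S hS hSc => hSc.image _ (e.continuousOn_symm.mono fun z hz => (hrV (hS hz)).1)
  have hout : ∀ x ∈ (K ∪ s)ᶜ, x ∈ e.source → e x ∉ (e ∘ σ) '' Icc (-d) d := by
    rintro x hx hxe ⟨t, ht, he⟩
    rw [← e.injOn (hσO t ht).1 hxe he] at hx
    exact hx (Or.inr (hσs.subset ⟨t, Ioc_subset_Icc_self (hdsub ht), rfl⟩))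
  have hD : e.source ∩ e ⁻¹' Metric.ball (e p) ε ∈ 𝓝 p :=
    Filter.inter_mem (e.open_source.mem_nhds hpe)
      ((e.continuousAt hpe).preimage_mem_nhds (Metric.ball_mem_nhds _ hA.eps_pos))
  obtain ⟨a, ha, b, hb, hab⟩ := hA.exists_two_points
  rw [hα0] at ha hb hab
  have hDx : ∀ x ∈ e.source ∩ e ⁻¹' Metric.ball (e p) ε, x ∈ (K ∪ s)ᶜ →
      e x ∈ Metric.ball (e p) ε \ (e ∘ σ) '' Icc (-d) d :=
    fun x hx hxU => ⟨hx.2, hout x hxU hx.1⟩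
  refine ⟨e.symm a, e.symm b, _, hfar δ hA.delta_pos, fun f hf hfab => ?_, ?_, ?_⟩
  · have hconn : ∀ z w, w ∈ connectedComponentIn
        (Metric.ball (e p) r \ (e ∘ σ) '' Icc (-d) d) z → f (e.symm w) = f (e.symm z) := by
      intro z w hw
      have hsub := connectedComponentIn_subset (Metric.ball (e p) r \ (e ∘ σ) '' Icc (-d) d) z
      refine hf.eq_of_isPreconnected (hmaps _ (hsub.trans sdiff_subset)
        isPreconnected_connectedComponentIn) ?_ (mem_image_of_mem _ hw) (mem_image_of_mem _ ?_)
      · rintro _ ⟨v, hv, rfl⟩ hvs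
        obtain ⟨t, ht, -, hvt⟩ := hsides v (hsub hv).1 hvs
        exact (hsub hv).2 ⟨t, ht, hvt.symm⟩
      · exact mem_connectedComponentIn (connectedComponentIn_nonempty_iff.1 ⟨w, hw⟩)
    refine ⟨f (e.symm a), ?_⟩
    filter_upwards [hD] with x hx hxU
    rw [← e.left_inv hx.1]
    rcases hab _ (hDx x hx hxU) with h1 | h1
    · exact hconn _ _ h1
    · exact (hconn _ _ h1).trans hfab.symm
  · rintro q ⟨hqM, hqs⟩ f hf ⟨c, hc⟩
    obtain ⟨t, ht, rfl⟩ := hnear δ hA.delta_pos q hqs hqM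
    obtain ⟨W, hWc, hW, htW⟩ := eventually_nhds_iff.1 hc
    obtain ⟨η, hη, hηW⟩ := Metric.isOpen_iff.1 (hW.preimage hσ) t htW
    have hf' : LocConstOn ((K ∪ s)ᶜ ∪ W) (fun x => if x ∈ W then c else f x) := by
      intro x hx
      by_cases hxW : x ∈ W
      · filter_upwards [hW.mem_nhds hxW] with y hy
        simp [hxW, hy]
      · filter_upwards [hf x (hx.resolve_right hxW),
          (hK.union (hσs ▸ isCompact_Icc.image hσ).isClosed).isOpen_compl.mem_nhds
            (hx.resolve_right hxW)] with y hy hyU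
        by_cases hyW : y ∈ W
        · simp [hxW, hyW, ← hy, hWc y hyW hyU]
        · simp [hxW, hyW, hy]
    have hff' : ∀ x ∈ (K ∪ s)ᶜ, (if x ∈ W then c else f x) = f x := by
      intro x hx
      split_ifs with hxW
      exacts [(hWc x hxW hx).symm, rfl]
    have hsub : Metric.ball (e p) r \ (e ∘ σ) '' (Icc (-d) d \ Ioo (t - η) (t + η)) ⊆
        e.symm ⁻¹' ((K ∪ s)ᶜ ∪ W) := by
      rintro v ⟨hv, hvA⟩
      by_contra hvU
      rw [mem_preimage, mem_union, not_or, notMem_compl_iff] at hvU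
      obtain ⟨t', ht', hvt, hvt'⟩ := hsides v hv hvU.1
      refine hvA ⟨t', ⟨ht', fun ht'' => hvU.2 ?_⟩, hvt'.symm⟩
      rw [hvt]
      exact hηW (by rwa [Real.ball_eq_Ioo])
    have key : ∀ x ∈ e.source ∩ e ⁻¹' Metric.ball (e p) ε, x ∈ (K ∪ s)ᶜ →
        f x = f (e.symm a) := by
      intro x hx hxU
      have hg := hA.mem_component_of_gap (by rw [hα0]; exact ha)
        (by rw [hα0]; exact hDx x hx hxU) ht hη
      rw [hα0] at hg
      have haU : e.symm a ∈ (K ∪ s)ᶜ := fun has => by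
        obtain ⟨t', ht', -, hat⟩ :=
          hsides a (Metric.ball_subset_ball (by linarith [hA.eps_le, hA.eps_pos]) ha.1) has
        exact ha.2 ⟨t', ht', hat.symm⟩
      have hcs := connectedComponentIn_subset
        (Metric.ball (e p) r \ (e ∘ σ) '' (Icc (-d) d \ Ioo (t - η) (t + η))) a
      have := hf'.eq_of_isPreconnected (hmaps _ (hcs.trans sdiff_subset)
        isPreconnected_connectedComponentIn) (image_subset_iff.2 (hcs.trans hsub))
        (mem_image_of_mem _ hg) (mem_image_of_mem _
          (mem_connectedComponentIn (connectedComponentIn_nonempty_iff.1 ⟨_, hg⟩)))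
      rw [e.left_inv hx.1] at this
      rwa [hff' x hxU, hff' _ haU] at this
    refine ⟨f (e.symm a), ?_⟩
    filter_upwards [hD] with x hx hxU
    exact key x hx hxU
  · have hfr : ∃ᶠ z in 𝓝 (e p), z ∉ (e ∘ σ) '' Icc (-d) d := by
      rw [Filter.frequently_iff]
      intro S hS
      by_contra! hcon
      have := mem_interior_iff_mem_nhds.2 (Filter.mem_of_superset hS hcon)
      rwa [interior_image_eq_empty isCompact_Icc hαc hαi] at this
    refine hsymm.frequently ((hfr.and_eventually (Metric.ball_mem_nhds _ hr)).mono ?_)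
    rintro z ⟨hz, hzr⟩ hzs
    obtain ⟨t, ht, -, hzt⟩ := hsides z hzr hzs
    exact hz ⟨t, ht, hzt.symm⟩

lemma isClosed_of_homeomorph_circle {X : Type} [TopologicalSpace X] [T2Space X] {s : Set X}
    (h : s ≃ₜ Circle) : IsClosed s :=
  (isCompact_iff_compactSpace.2 h.symm.compactSpace).isClosed

lemma isClosed_sUnion_of_homeomorph_circle {X : Type} [TopologicalSpace X] [T2Space X]
    {N : Finset (Set X)} (hN : ∀ s ∈ N, Nonempty (s ≃ₜ Circle)) :
    IsClosed (⋃₀ (N : Set (Set X))) := by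
  rw [sUnion_eq_biUnion]
  exact N.finite_toSet.isClosed_biUnion fun s hs => isClosed_of_homeomorph_circle (hN s hs).some

section Surface

variable {X : Type} [TopologicalSpace X] [ChartedSpace (EuclideanSpace ℝ (Fin 2)) X]

/-- A surface is locally homeomorphic to `ℂ`. -/
lemma exists_openPartialHomeomorph_complex (p : X) :
    ∃ e : OpenPartialHomeomorph X ℂ, p ∈ e.source :=
  ⟨(chartAt (EuclideanSpace ℝ (Fin 2)) p).transHomeomorph
    Complex.orthonormalBasisOneI.repr.toHomeomorph.symm, mem_chart_source _ p⟩

variable [T2Space X]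

/-- One linear condition ensures that locally constant functions extend across a connected
piece of the noose `s` that avoids `K`. -/
lemma exists_nearConst_of_isPreconnected {K s C : Set X} (hK : IsClosed K) (h : s ≃ₜ Circle)
    (hC : IsPreconnected C) (hCs : C ⊆ s \ K) :
    ∃ a b, ∀ f, LocConstOn (K ∪ s)ᶜ f → f a = f b → ∀ q ∈ C, NearConst (K ∪ s)ᶜ f q := by
  rcases C.eq_empty_or_nonempty with rfl | ⟨p, hp⟩
  · exact ⟨h.symm 1, h.symm 1, fun _ _ _ _ => False.elim⟩
  obtain ⟨e, he⟩ := exists_openPartialHomeomorph_complex p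
  obtain ⟨a, b, -, -, hab, -⟩ := exists_local_sides hK h (hCs hp) e he
  refine ⟨a, b, fun f hf hfab q hq => ?_⟩
  by_contra hqn
  have hM : ∀ x ∈ C, ∃ M ∈ 𝓝 x, ∀ y ∈ M ∩ s, NearConst (K ∪ s)ᶜ f y →
      NearConst (K ∪ s)ᶜ f x := by
    intro x hx
    obtain ⟨e, he⟩ := exists_openPartialHomeomorph_complex x
    obtain ⟨-, -, M, hM, -, hMs, -⟩ := exists_local_sides hK h (hCs hx) e he
    exact ⟨M, hM, fun y hy => hMs y hy f hf⟩
  choose! M hMx hMs using hM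
  obtain ⟨z, hzC, hz, hzv⟩ := hC {x | NearConst (K ∪ s)ᶜ f x}
    (⋃ x ∈ C ∩ {x | ¬ NearConst (K ∪ s)ᶜ f x}, interior (M x)) (isOpen_nearConst _ _)
    (isOpen_biUnion fun _ _ => isOpen_interior)
    (fun x hx => by
      by_cases hxn : NearConst (K ∪ s)ᶜ f x
      · exact Or.inl hxn
      · exact Or.inr (mem_biUnion ⟨hx, hxn⟩ (mem_interior_iff_mem_nhds.2 (hMx x hx))))
    ⟨p, hp, hab f hf hfab⟩
    ⟨q, hq, mem_biUnion ⟨hq, hqn⟩ (mem_interior_iff_mem_nhds.2 (hMx q hq))⟩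
  obtain ⟨x, ⟨hx, hxn⟩, hzx⟩ := mem_iUnion₂.1 hzv
  exact hxn (hMs x hx z ⟨interior_subset hzx, (hCs hzC).1⟩ hz)

end Surface

/-- A circle minus `n` points is covered by at most `max 1 n` connected pieces. -/
lemma exists_cover_compl_circle {F : Set Circle} (hF : F.Finite) :
    ∃ S : Fin (max 1 F.ncard) → Set Circle, (∀ i, IsPreconnected (S i)) ∧ ⋃ i, S i = Fᶜ := by
  rcases F.eq_empty_or_nonempty with rfl | hne
  · refine ⟨fun _ => univ, fun _ => isPreconnected_univ, ?_⟩
    have : Nonempty (Fin (max 1 (∅ : Set Circle).ncard)) := ⟨⟨0, by simp⟩⟩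
    simp [iUnion_const]
  have hcard : max 1 F.ncard = F.ncard := max_eq_right ((ncard_pos hF).2 hne)
  let S : Circle → Set Circle := fun q => {x | ∃ θ > 0, x = q * Circle.exp θ ∧
    ∀ u ∈ Ioc 0 θ, q * Circle.exp u ∉ F}
  have hSc : ∀ q, IsPreconnected (S q) := by
    intro q
    have hS : S q = (fun u => q * Circle.exp u) ''
        {θ | 0 < θ ∧ ∀ u ∈ Ioc 0 θ, q * Circle.exp u ∉ F} := by
      ext x
      constructor
      · rintro ⟨θ, h0, rfl, hu⟩
        exact ⟨θ, ⟨h0, hu⟩, rfl⟩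
      · rintro ⟨θ, ⟨h0, hu⟩, rfl⟩
        exact ⟨θ, h0, rfl, hu⟩
    rw [hS]
    refine IsPreconnected.image (OrdConnected.isPreconnected ⟨?_⟩) _ (by fun_prop)
    rintro x ⟨hx, -⟩ y ⟨-, hy⟩ z ⟨hxz, hzy⟩
    exact ⟨hx.trans_le hxz, fun u hu => hy u ⟨hu.1, hu.2.trans hzy⟩⟩
  have hSF : ∀ q, S q ⊆ Fᶜ := by
    rintro q _ ⟨θ, h0, rfl, hu⟩
    exact hu θ ⟨h0, le_rfl⟩
  have hcov : ∀ x ∉ F, ∃ q ∈ F, x ∈ S q := by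
    intro x hx
    obtain ⟨q₀, hq₀⟩ := hne
    have hT : IsClosed (Ici 0 ∩ (fun u : ℝ => x * Circle.exp (-u)) ⁻¹' F) :=
      isClosed_Ici.inter (hF.isClosed.preimage (by fun_prop))
    have hTne : (Ici 0 ∩ (fun u : ℝ => x * Circle.exp (-u)) ⁻¹' F).Nonempty := by
      obtain ⟨v, hv⟩ : ∃ v, Circle.exp v = x⁻¹ * q₀ := ⟨_, Circle.exp_arg _⟩
      obtain ⟨n, hn⟩ := exists_nat_ge (v / (2 * Real.pi))
      rw [div_le_iff₀ (by positivity)] at hn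
      refine ⟨n * (2 * Real.pi) - v, sub_nonneg.2 hn, ?_⟩
      rw [mem_preimage, neg_sub, Circle.periodic_exp.sub_nat_mul_eq, hv, mul_inv_cancel_left]
      exact hq₀
    have hbdd : BddBelow (Ici 0 ∩ (fun u : ℝ => x * Circle.exp (-u)) ⁻¹' F) := ⟨0, fun u hu => hu.1⟩
    obtain ⟨h0, hmem⟩ := hT.csInf_mem hTne hbdd
    set θ := sInf (Ici 0 ∩ (fun u : ℝ => x * Circle.exp (-u)) ⁻¹' F)
    refine ⟨_, hmem, θ, lt_of_le_of_ne h0 fun h => ?_, ?_, fun u hu huF => ?_⟩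
    · rw [mem_preimage, ← h, neg_zero, Circle.exp_zero, mul_one] at hmem
      exact hx hmem
    · rw [mul_assoc, ← Circle.exp_add, neg_add_cancel, Circle.exp_zero, mul_one]
    · rw [mul_assoc, ← Circle.exp_add] at huF
      have := csInf_le hbdd (show θ - u ∈ _ from
        ⟨sub_nonneg.2 hu.2, by rwa [mem_preimage, neg_sub, sub_eq_neg_add]⟩)
      linarith [hu.1]
  have := hF.to_subtype
  let E : Fin (max 1 F.ncard) ≃ F := (finCongr hcard).trans (Finite.equivFin F).symm
  refine ⟨fun i => S (E i), fun i => hSc _, Subset.antisymm (iUnion_subset fun i => hSF _)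
    fun x hx => ?_⟩
  obtain ⟨q, hq, hxq⟩ := hcov x hx
  exact mem_iUnion.2 ⟨E.symm ⟨q, hq⟩, by rwa [Equiv.apply_symm_apply]⟩

/-- Removing a noose `s` from the complement of `K` increases the dimension of the space of locally
constant functions by at most `max 1 n`, where `n` is the number of points of `s` on `K`. -/
lemma rank_locConstSubmodule_compl_union_le {X : Type} [TopologicalSpace X] [T2Space X]
    [ChartedSpace (EuclideanSpace ℝ (Fin 2)) X] {K s : Set X} (hK : IsClosed K) (h : s ≃ₜ Circle)
    (hfin : (K ∩ s).Finite) :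
    Module.rank ℝ (locConstSubmodule (K ∪ s)ᶜ) ≤
      Module.rank ℝ (locConstSubmodule Kᶜ) + (max 1 (K ∩ s).ncard : ℕ) := by
  obtain ⟨g, hgc, hgi, hgr⟩ : ∃ g : Circle → X, Continuous g ∧ Function.Injective g ∧ range g = s :=
    ⟨Subtype.val ∘ h.symm, by fun_prop, Subtype.val_injective.comp h.symm.injective, by
      rw [range_comp, h.symm.surjective.range_eq, image_univ, Subtype.range_coe]⟩
  obtain ⟨S, hSc, hSu⟩ := exists_cover_compl_circle (hfin.preimage hgi.injOn)
  have hcard : (g ⁻¹' (K ∩ s)).ncard = (K ∩ s).ncard := by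
    rw [← ncard_image_of_injective _ hgi,
      image_preimage_eq_of_subset (hgr.symm ▸ inter_subset_right)]
  rw [← hcard]
  have hSsub : ∀ i, g '' S i ⊆ s \ K := by
    rintro i _ ⟨z, hz, rfl⟩
    have hzs : g z ∈ s := hgr.subset (mem_range_self z)
    exact ⟨hzs, fun hzK => hSu.subset (mem_iUnion.2 ⟨i, hz⟩) ⟨hzK, hzs⟩⟩
  choose a b hab using fun i => exists_nearConst_of_isPreconnected hK h
    ((hSc i).image g hgc.continuousOn) (hSsub i)
  have hU : IsOpen (K ∪ s)ᶜ := (hK.union (isClosed_of_homeomorph_circle h)).isOpen_compl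
  have hsub : (K ∪ s)ᶜ ⊆ Kᶜ := compl_subset_compl.2 subset_union_left
  refine rank_locConstSubmodule_le hU hsub a b fun f hf hfab =>
    exists_extension_of_nearConst hK.isOpen_compl hsub (fun p hp => ?_) fun p hp => ?_
  · by_cases hps : p ∈ s
    · obtain ⟨z, rfl⟩ := hgr.symm.subset hps
      obtain ⟨i, hi⟩ := mem_iUnion.1 (hSu.symm.subset fun hz : g z ∈ K ∩ s => hp hz.1)
      exact hab i f hf.1 (hfab i) _ (mem_image_of_mem g hi)
    · exact ⟨f p, (hf.1 p (not_or.2 ⟨hp, hps⟩)).mono fun _ hx _ => hx⟩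
  · by_cases hps : p ∈ s
    · obtain ⟨e, he⟩ := exists_openPartialHomeomorph_complex p
      obtain ⟨-, -, -, -, -, -, hd⟩ := exists_local_sides hK h ⟨hps, hp⟩ e he
      exact hd
    · exact Filter.Eventually.frequently (hU.mem_nhds (not_or.2 ⟨hp, hps⟩))

lemma mem_sUnion_iff_nooseCount_pos {X : Type} {N : Finset (Set X)} {p : X} :
    p ∈ ⋃₀ (N : Set (Set X)) ↔ 0 < nooseCount N p := by
  rw [nooseCount, ncard_pos (N.finite_toSet.subset fun _ ht => ht.1)]
  rfl

lemma nooseCount_insert {X : Type} [DecidableEq (Set X)] {N : Finset (Set X)} {s : Set X}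
    (hs : s ∉ N) (p : X) [Decidable (p ∈ s)] :
    nooseCount (insert s N) p = nooseCount N p + if p ∈ s then 1 else 0 := by
  have hfin : {t : Set X | t ∈ N ∧ p ∈ t}.Finite := N.finite_toSet.subset fun _ ht => ht.1
  split_ifs with hp
  · rw [nooseCount, nooseCount, ← ncard_insert_of_notMem (fun ht => hs ht.1) hfin]
    congr 1
    ext t
    simp only [Finset.mem_insert, mem_ofPred_eq, mem_insert_iff]
    grind
  · rw [nooseCount, nooseCount, add_zero]
    congr 1
    ext t
    simp only [Finset.mem_insert, mem_ofPred_eq]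
    grind

lemma rank_locConstSubmodule_compl_sUnion_le {X : Type} [TopologicalSpace X] [T2Space X]
    [ChartedSpace (EuclideanSpace ℝ (Fin 2)) X] (N : Finset (Set X))
    (hN : ∀ s ∈ N, Nonempty (s ≃ₜ Circle)) (F : Finset X)
    (hF : ∀ p, 2 ≤ nooseCount N p → p ∈ F) :
    Module.rank ℝ (locConstSubmodule (⋃₀ (N : Set (Set X)))ᶜ) ≤
      Module.rank ℝ (locConstSubmodule (univ : Set X)) +
        (N.card + ∑ p ∈ F, (nooseCount N p - 1) : ℕ) := by
  classical
  induction N using Finset.induction_on with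
  | empty =>
    rw [Finset.coe_empty, sUnion_empty, compl_empty]
    exact le_self_add
  | insert s N hs ih =>
    have hNs := fun t ht => hN t (Finset.mem_insert_of_mem ht)
    obtain ⟨h⟩ := hN s (Finset.mem_insert_self s N)
    have hK := isClosed_sUnion_of_homeomorph_circle hNs
    have hsub : ∀ p ∈ ⋃₀ (N : Set (Set X)) ∩ s, p ∈ F := fun p hp => hF p (by
      rw [nooseCount_insert hs, if_pos hp.2]
      have := mem_sUnion_iff_nooseCount_pos.1 hp.1
      omega)
    have hcard : (⋃₀ (N : Set (Set X)) ∩ s).ncard =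
        ∑ p ∈ F, if p ∈ ⋃₀ (N : Set (Set X)) ∩ s then 1 else 0 := by
      rw [← Finset.card_filter, ← ncard_coe_finset]
      congr 1
      ext p
      simpa using hsub p
    have hsum : ∑ p ∈ F, (nooseCount (insert s N) p - 1) =
        ∑ p ∈ F, (nooseCount N p - 1) + (⋃₀ (N : Set (Set X)) ∩ s).ncard := by
      rw [hcard, ← Finset.sum_add_distrib]
      refine Finset.sum_congr rfl fun p _ => ?_
      have hp : p ∈ ⋃₀ (N : Set (Set X)) ∩ s ↔ 0 < nooseCount N p ∧ p ∈ s :=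
        and_congr_left' mem_sUnion_iff_nooseCount_pos
      rw [nooseCount_insert hs]
      split_ifs <;> grind
    have hstep := rank_locConstSubmodule_compl_union_le hK h (F.finite_toSet.subset hsub)
    have hind := ih hNs fun p hp => hF p (by rw [nooseCount_insert hs]; omega)
    rw [Finset.coe_insert, sUnion_insert, union_comm]
    refine hstep.trans ((add_le_add_left hind _).trans ?_)
    rw [add_assoc, ← Nat.cast_add, hsum, Finset.card_insert_of_notMem hs]
    refine add_le_add_right (Nat.cast_le.2 ?_) _
    omega

end Nooses

/-- Let `N` be a finite family of nooses (embedded circles) on a compact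
surface `X`, let `P(N)` be the set of points lying on at least two of them and
`θ(N) = Σ_{p ∈ P(N)} (N(p) - 1)`. If `θ(N)` is finite (i.e. `P(N)` is finite),
then `P(N)`, the vertex set of the union of the nooses viewed as an embedded
graph, has at most `θ(N)` points, and the number of connected components of
the complement of the union of the nooses is at most `|N| + θ(N)` plus a
constant depending only on the surface. -/
theorem nooses_regions_bound
    (X : Type) [TopologicalSpace X] [T2Space X] [CompactSpace X]
    [ChartedSpace (EuclideanSpace ℝ (Fin 2)) X] :
    ∃ c : ℕ, ∀ N : Finset (Set X),
      (∀ s ∈ N, Nonempty (↥s ≃ₜ Circle)) →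
      ∀ hP : {p : X | 2 ≤ nooseCount N p}.Finite,
        {p : X | 2 ≤ nooseCount N p}.ncard ≤
          ∑ p ∈ hP.toFinset, (nooseCount N p - 1) ∧
        Nat.card (ConnectedComponents ↥((⋃₀ (N : Set (Set X)))ᶜ)) ≤
          N.card + (∑ p ∈ hP.toFinset, (nooseCount N p - 1)) + c := by
  have := ChartedSpace.locallyConnectedSpace (EuclideanSpace ℝ (Fin 2)) X
  obtain ⟨c, hc⟩ := exists_rank_locConstSubmodule_univ_le X
  refine ⟨c, fun N hN hP => ⟨?_, ?_⟩⟩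
  · rw [Set.ncard_eq_toFinset_card _ hP, Finset.card_eq_sum_ones]
    refine Finset.sum_le_sum fun p hp => ?_
    have : 2 ≤ nooseCount N p := hP.mem_toFinset.1 hp
    omega
  · refine natCard_connectedComponents_le (isClosed_sUnion_of_homeomorph_circle hN).isOpen_compl
      ((rank_locConstSubmodule_compl_sUnion_le N hN hP.toFinset fun p hp =>
        hP.mem_toFinset.2 hp).trans ?_)
    rw [Nat.cast_add _ c, add_comm]
    exact add_le_add_right hc _
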